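/- arXiv:2402.01340 — 5 statements merged into one kernel-verified Lean document; each statement's English description precedes it below -/
import Mathlib

section
/- Let f : ℝ^N → ℝ be differentiable, bounded below by f⋆, coordinate-wise smooth with constants L_1,…,L_N ≥ 0 and ‖L‖₁ > 0, and let the random iterates x^{t+1} = x^t − δ·Û^t be generated as described with learning rate δ = sqrt(2(f(x^1) − f⋆)/(T‖L‖₁)). If for every t ∈ {1,…,T} and every coordinate n ∈ {1,…,N} the conditional probability of a sign-decoding error satisfies P[Û_n^t ≠ sign(∂_n f(x^t)) | σ(Û^1,…,Û^{t−1})] ≤ P_E^max almost surely, for a constant P_E^max ∈ [0, 1/2), then E[(1/T) Σ_{t=1}^T ‖∇f(x^t)‖₁] ≤ (1/(1 − 2·P_E^max)) · sqrt(2·(f(x^1) − f⋆)·‖L‖₁ / T). -/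
open Finset MeasureTheory ProbabilityTheory
open scoped ProbabilityTheory RealInnerProductSpace

/-- The sign function used by signSGD: `sgn a = 1` if `a ≥ 0`, and `-1` otherwise. -/
noncomputable def sgn (a : ℝ) : ℝ := if 0 ≤ a then 1 else -1

/-- If the conditional expectation of `Z` is at most `c`, then integrating `Z` against a
nonnegative weight `h` measurable for the conditioning σ-algebra gives at most `c ∫ h`. -/
theorem integral_mul_le_of_condExp_le {Ω : Type*} {m mΩ : MeasurableSpace Ω} {μ : Measure Ω}
    [IsFiniteMeasure μ] (hm : m ≤ mΩ) {h Z : Ω → ℝ} {c : ℝ} (hh : StronglyMeasurable[m] h)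
    (hpos : ∀ ω, 0 ≤ h ω) (hhi : Integrable h μ) (hZ : Integrable Z μ)
    (hhZ : Integrable (fun ω => h ω * Z ω) μ) (hc : ∀ᵐ ω ∂μ, (μ[Z | m]) ω ≤ c) :
    ∫ ω, h ω * Z ω ∂μ ≤ c * ∫ ω, h ω ∂μ := by
  have hpull : μ[h * Z | m] =ᵐ[μ] h * μ[Z | m] :=
    condExp_mul_of_stronglyMeasurable_left hh hhZ hZ
  rw [← integral_const_mul]
  calc ∫ ω, h ω * Z ω ∂μ = ∫ ω, (μ[h * Z | m]) ω ∂μ := (integral_condExp hm).symm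
    _ ≤ ∫ ω, c * h ω ∂μ := by
      refine integral_mono_ae integrable_condExp (hhi.const_mul c) ?_
      filter_upwards [hpull, hc] with ω h1 h2
      rw [h1, Pi.mul_apply, mul_comm]
      exact mul_le_mul_of_nonneg_right h2 (hpos ω)

/-- A measurable function on a finite measure space is integrable if it factors through a map
with finite range. -/
theorem integrable_comp_of_finite_range {Ω E : Type*} {mΩ : MeasurableSpace Ω} {μ : Measure Ω}
    [IsFiniteMeasure μ] {X : Ω → E} (hX : (Set.range X).Finite) {g : E → ℝ}
    (hg : Measurable fun ω => g (X ω)) : Integrable (fun ω => g (X ω)) μ := by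
  obtain ⟨C, hC⟩ := (hX.image fun x => ‖g x‖).bddAbove
  exact Integrable.of_bound hg.aestronglyMeasurable C
    (.of_forall fun ω => hC ⟨X ω, ⟨ω, rfl⟩, rfl⟩)

/-- Sign vectors form a finite set. -/
theorem finite_sign_vectors (N : ℕ) :
    {u : EuclideanSpace ℝ (Fin N) | ∀ n, u n = 1 ∨ u n = -1}.Finite := by
  have h : (Set.univ.pi fun _ : Fin N => ({1, -1} : Set ℝ)).Finite :=
    Set.Finite.pi fun _ => Set.toFinite _
  refine (h.image (WithLp.toLp 2)).subset fun u hu => ⟨fun n => u n, ?_, rfl⟩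
  intro n _
  simpa using hu n

/-- The gradient of a differentiable function is measurable. -/
theorem measurable_gradient_of_euclidean {N : ℕ} (f : EuclideanSpace ℝ (Fin N) → ℝ) :
    Measurable (gradient f) :=
  (InnerProductSpace.toDual ℝ (EuclideanSpace ℝ (Fin N))).symm.continuous.measurable.comp
    (measurable_fderiv ℝ f)

/-- Multiplying `a` by a sign gives `|a|`, up to a loss of `2 |a|` if the sign is wrong. -/
theorem mul_sign_eq {a u : ℝ} (hu : u = 1 ∨ u = -1) :
    a * u = |a| - 2 * (|a| * if u ≠ sgn a then 1 else 0) := by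
  unfold sgn
  rcases le_or_gt 0 a with ha | ha
  · rcases hu with rfl | rfl
    · simp [ha, abs_of_nonneg ha]
    · norm_num [ha, abs_of_nonneg ha]
      ring
  · rcases hu with rfl | rfl
    · norm_num [ha.not_ge, abs_of_neg ha]
      ring
    · simp [ha.not_ge, abs_of_neg ha]

/-- The step size balances the initial gap against the accumulated smoothness error. -/
theorem average_le_of_mul_le {D S T P A δ : ℝ} (hD : 0 < D) (hS : 0 < S) (hT : 0 < T)
    (hP : P < 1 / 2) (hδ : δ = √(2 * D / (T * S)))
    (h : δ * (1 - 2 * P) * A ≤ D + T * (δ ^ 2 / 2 * S)) :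
    1 / T * A ≤ 1 / (1 - 2 * P) * √(2 * D * S / T) := by
  have hδpos : 0 < δ := hδ ▸ Real.sqrt_pos.2 (by positivity)
  have hsq : δ ^ 2 = 2 * D / (T * S) := by rw [hδ, Real.sq_sqrt (by positivity)]
  have hTS : δ ^ 2 * (T * S) = 2 * D := by rw [hsq]; field_simp
  have hroot : √(2 * D * S / T) = δ * S := by
    rw [← Real.sqrt_sq (by positivity : 0 ≤ δ * S)]
    congr 1
    rw [mul_pow, hsq]
    field_simp
  have hq : 0 < 1 - 2 * P := by linarith
  rw [hroot, one_div_mul_eq_div, one_div_mul_eq_div, div_le_div_iff₀ hT hq]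
  refine le_of_mul_le_mul_left ?_ hδpos
  nlinarith

/-- One step of sign descent decreases `f` up to sign errors and the smoothness error. -/
theorem sign_step_descent {N : ℕ} {f : EuclideanSpace ℝ (Fin N) → ℝ} {L : Fin N → ℝ}
    (hsmooth : ∀ x y : EuclideanSpace ℝ (Fin N),
      |f y - f x - ⟪gradient f x, y - x⟫| ≤ ∑ n, L n / 2 * (y n - x n) ^ 2)
    (δ : ℝ) (x u : EuclideanSpace ℝ (Fin N)) (hu : ∀ n, u n = 1 ∨ u n = -1) :
    δ * (∑ n, |gradient f x n| -
        2 * ∑ n, |gradient f x n| * if u n ≠ sgn (gradient f x n) then 1 else 0) ≤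
      f x - f (x - δ • u) + δ ^ 2 / 2 * ∑ n, L n := by
  have h := (abs_le.1 (hsmooth x (x - δ • u))).2
  have hquad : ∑ n, L n / 2 * ((x - δ • u) n - x n) ^ 2 = δ ^ 2 / 2 * ∑ n, L n := by
    rw [mul_sum]
    refine sum_congr rfl fun n _ => ?_
    have hu2 : u n ^ 2 = 1 := by rcases hu n with h | h <;> rw [h] <;> norm_num
    simp only [PiLp.sub_apply, PiLp.smul_apply, smul_eq_mul]
    linear_combination L n / 2 * δ ^ 2 * hu2
  have hinner : ⟪gradient f x, (x - δ • u) - x⟫ = -(δ * ∑ n, gradient f x n * u n) := by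
    rw [sub_sub_cancel_left, inner_neg_right, inner_smul_right, PiLp.inner_apply]
    simp [mul_comm]
  rw [hquad, hinner] at h
  rw [mul_sum _ _ (2 : ℝ), ← sum_sub_distrib, sum_congr rfl fun n _ => (mul_sign_eq (hu n)).symm]
  linarith

/-- Universal convergence rate of signSGD-type algorithms: let `f` be differentiable, bounded
below by `f⋆`, and coordinate-wise smooth with constants `L n ≥ 0`, `‖L‖₁ > 0`.  The random
iterates satisfy `x^{t+1} = x^t - δ·Û^t`, where `Û^t ∈ {-1,+1}^N` and
`δ = √(2(f(x¹) - f⋆)/(T‖L‖₁))`.  If, for each round `t < T` and coordinate `n`, the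
conditional probability (given the σ-algebra generated by `Û^0,…,Û^{t-1}`) that `Û^t_n`
differs from `sign(∂ₙ f(x^t))` is a.s. at most `P_E^max < 1/2`, then
`E[(1/T)∑_t ‖∇f(x^t)‖₁] ≤ (1 - 2 P_E^max)⁻¹ · √(2(f(x¹) - f⋆)‖L‖₁/T)`. -/
theorem signSGD_universal_convergence_rate {N T : ℕ} (hT : 0 < T)
    {Ω : Type*} [MeasureSpace Ω] [IsProbabilityMeasure (ℙ : Measure Ω)]
    (f : EuclideanSpace ℝ (Fin N) → ℝ) (hf : Differentiable ℝ f)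
    (fstar : ℝ) (hlb : ∀ x, fstar ≤ f x)
    (L : Fin N → ℝ) (hL : ∀ n, 0 ≤ L n) (hLpos : 0 < ∑ n, L n)
    (hsmooth : ∀ x y : EuclideanSpace ℝ (Fin N),
      |f y - f x - ⟪gradient f x, y - x⟫| ≤ ∑ n, L n / 2 * (y n - x n) ^ 2)
    (U : ℕ → Ω → EuclideanSpace ℝ (Fin N)) (hUmeas : ∀ t, Measurable (U t))
    (hUval : ∀ t ω n, U t ω n = 1 ∨ U t ω n = -1)
    (x1 : EuclideanSpace ℝ (Fin N)) (hx1 : fstar < f x1)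
    (δ : ℝ) (hδ : δ = Real.sqrt (2 * (f x1 - fstar) / (T * ∑ n, L n)))
    (X : ℕ → Ω → EuclideanSpace ℝ (Fin N)) (hX0 : ∀ ω, X 0 ω = x1)
    (hXrec : ∀ t ω, X (t + 1) ω = X t ω - δ • U t ω)
    (PEmax : ℝ) (hPE0 : 0 ≤ PEmax) (hPE : PEmax < 1 / 2)
    (hcond : ∀ t < T, ∀ n : Fin N, ∀ᵐ ω ∂ℙ,
      (ℙ[Set.indicator {ω' | U t ω' n ≠ sgn (gradient f (X t ω') n)} (fun _ => (1 : ℝ)) |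
          ⨆ s : Fin t, MeasurableSpace.comap (U s) inferInstance]) ω ≤ PEmax) :
    (∫ ω, (1 / T : ℝ) * ∑ t ∈ Finset.range T, ∑ n, |gradient f (X t ω) n| ∂ℙ) ≤
      1 / (1 - 2 * PEmax) *
        Real.sqrt (2 * (f x1 - fstar) * (∑ n, L n) / T) := by
  have hfin : ∀ t, (Set.range (X t)).Finite := by
    intro t
    induction t with
    | zero =>
      exact (Set.finite_singleton x1).subset (by rintro _ ⟨ω, rfl⟩; exact hX0 ω)
    | succ t ih =>
      refine (ih.image2 (fun x u => x - δ • u) (finite_sign_vectors N)).subset ?_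
      rintro _ ⟨ω, rfl⟩
      exact ⟨X t ω, ⟨ω, rfl⟩, U t ω, hUval t ω, (hXrec t ω).symm⟩
  have hadapt : ∀ (m : MeasurableSpace Ω) t, (∀ s < t, Measurable[m] (U s)) →
      Measurable[m] (X t) := by
    intro m t
    induction t with
    | zero =>
      intro _
      rw [funext hX0]
      exact measurable_const
    | succ t ih =>
      intro h
      rw [funext (hXrec t)]
      exact (ih fun s hs => h s (hs.trans t.lt_succ_self)).sub
        ((h t t.lt_succ_self).const_smul δ)
  have hXmeas : ∀ t, Measurable (X t) := fun t => hadapt _ t fun s _ => hUmeas s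
  have hgrad : ∀ n, Measurable fun x => gradient f x n := fun n =>
    (EuclideanSpace.proj (𝕜 := ℝ) n).continuous.measurable.comp
      (measurable_gradient_of_euclidean f)
  have hsgn : Measurable sgn := Measurable.ite measurableSet_Ici measurable_const measurable_const
  have herr : ∀ t n, MeasurableSet {ω | U t ω n ≠ sgn (gradient f (X t ω) n)} := by
    intro t n
    have hUn : Measurable fun ω => U t ω n :=
      (EuclideanSpace.proj (𝕜 := ℝ) n).continuous.measurable.comp (hUmeas t)
    exact (measurableSet_eq_fun hUn (hsgn.comp ((hgrad n).comp (hXmeas t)))).compl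
  have hint_f : ∀ t, Integrable (fun ω => f (X t ω)) ℙ := fun t =>
    integrable_comp_of_finite_range (hfin t) (hf.continuous.measurable.comp (hXmeas t))
  have hint_g : ∀ t n, Integrable (fun ω => |gradient f (X t ω) n|) ℙ := fun t n =>
    integrable_comp_of_finite_range (g := fun x => |gradient f x n|) (hfin t)
      ((hgrad n).comp (hXmeas t)).abs
  let Z : ℕ → Fin N → Ω → ℝ := fun t n =>
    Set.indicator {ω | U t ω n ≠ sgn (gradient f (X t ω) n)} fun _ => 1
  have hint_Z : ∀ t n, Integrable (Z t n) ℙ := fun t n =>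
    (integrable_const 1).indicator (herr t n)
  have hint_gZ : ∀ t n, Integrable (fun ω => |gradient f (X t ω) n| * Z t n ω) ℙ := by
    intro t n
    refine ((hint_g t n).indicator (herr t n)).congr (.of_forall fun ω => ?_)
    simp [Z, Set.indicator_apply]
  have hbound : ∀ t < T, ∀ n, ∫ ω, |gradient f (X t ω) n| * Z t n ω ∂ℙ ≤
      PEmax * ∫ ω, |gradient f (X t ω) n| ∂ℙ := by
    intro t ht n
    refine integral_mul_le_of_condExp_le
      (m := ⨆ s : Fin t, MeasurableSpace.comap (U s) inferInstance)
      (iSup_le fun s => (hUmeas s).comap_le) ?_ (fun ω => abs_nonneg _) (hint_g t n)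
      (hint_Z t n) (hint_gZ t n) (hcond t ht n)
    refine Measurable.stronglyMeasurable ?_
    refine ((continuous_abs.measurable.comp (hgrad n)).comp (hadapt _ t fun s hs => ?_))
    exact (comap_measurable (U s)).mono
      (le_iSup (fun s : Fin t => MeasurableSpace.comap (U s) inferInstance) ⟨s, hs⟩) le_rfl
  have hδ0 : 0 ≤ δ := hδ ▸ Real.sqrt_nonneg _
  have hstep : ∀ t < T, δ * (1 - 2 * PEmax) * ∑ n, ∫ ω, |gradient f (X t ω) n| ∂ℙ ≤
      ∫ ω, f (X t ω) ∂ℙ - ∫ ω, f (X (t + 1) ω) ∂ℙ + δ ^ 2 / 2 * ∑ n, L n := by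
    intro t ht
    have hi1 : Integrable (fun ω => ∑ n, |gradient f (X t ω) n|) ℙ :=
      integrable_finsetSum _ fun n _ => hint_g t n
    have hi2 : Integrable (fun ω => ∑ n, |gradient f (X t ω) n| * Z t n ω) ℙ :=
      integrable_finsetSum _ fun n _ => hint_gZ t n
    have hrhs : ∫ ω, (f (X t ω) - f (X (t + 1) ω) + δ ^ 2 / 2 * ∑ n, L n) ∂ℙ =
        ∫ ω, f (X t ω) ∂ℙ - ∫ ω, f (X (t + 1) ω) ∂ℙ + δ ^ 2 / 2 * ∑ n, L n := by
      rw [integral_add (f := fun ω => f (X t ω) - f (X (t + 1) ω))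
        ((hint_f t).sub (hint_f (t + 1))) (integrable_const _),
        integral_sub (hint_f t) (hint_f (t + 1)), integral_const, probReal_univ, one_smul]
    have hmono : ∫ ω, δ * (∑ n, |gradient f (X t ω) n| -
          2 * ∑ n, |gradient f (X t ω) n| * Z t n ω) ∂ℙ ≤
        ∫ ω, (f (X t ω) - f (X (t + 1) ω) + δ ^ 2 / 2 * ∑ n, L n) ∂ℙ := by
      refine integral_mono ((hi1.sub (hi2.const_mul 2)).const_mul δ)
        (((hint_f t).sub (hint_f (t + 1))).add (integrable_const _)) fun ω => ?_
      simpa only [hXrec, Z, Set.indicator_apply, Set.mem_ofPred_eq] using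
        sign_step_descent hsmooth δ (X t ω) (U t ω) (hUval t ω)
    rw [integral_const_mul, integral_sub hi1 (hi2.const_mul 2), integral_const_mul,
      integral_finsetSum _ fun n _ => hint_g t n, integral_finsetSum _ fun n _ => hint_gZ t n,
      hrhs] at hmono
    have hsum : ∑ n, ∫ ω, |gradient f (X t ω) n| * Z t n ω ∂ℙ ≤
        PEmax * ∑ n, ∫ ω, |gradient f (X t ω) n| ∂ℙ := by
      rw [mul_sum]
      exact sum_le_sum fun n _ => hbound t ht n
    linarith [mul_le_mul_of_nonneg_left hsum hδ0]
  have htotal : δ * (1 - 2 * PEmax) * ∑ t ∈ range T, ∑ n, ∫ ω, |gradient f (X t ω) n| ∂ℙ ≤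
      (f x1 - fstar) + T * (δ ^ 2 / 2 * ∑ n, L n) := by
    have h := sum_le_sum fun t ht => hstep t (mem_range.1 ht)
    rw [← mul_sum, sum_add_distrib, sum_range_sub' (fun t => ∫ ω, f (X t ω) ∂ℙ), sum_const,
      card_range, nsmul_eq_mul] at h
    have h0 : ∫ ω, f (X 0 ω) ∂ℙ = f x1 := by simp [hX0]
    have hlast : fstar ≤ ∫ ω, f (X T ω) ∂ℙ := by
      simpa using integral_mono (integrable_const fstar) (hint_f T) fun ω => hlb (X T ω)
    linarith
  rw [integral_const_mul, integral_finsetSum _ fun t _ =>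
    integrable_finsetSum _ fun n _ => hint_g t n,
    sum_congr rfl fun t _ => integral_finsetSum _ fun n _ => hint_g t n]
  exact average_le_of_mul_le (sub_pos.2 hx1) hLpos (Nat.cast_pos.2 hT) hPE hδ htotal
end

section
/- Let f : ℝ^N → ℝ be differentiable and coordinate-wise smooth with constants L_1,…,L_N ≥ 0. For any x ∈ ℝ^N, any δ > 0, and any vector Û ∈ {−1,+1}^N, setting x' = x − δ·Û, one has f(x') − f(x) ≤ −δ·‖∇f(x)‖₁ + (δ²/2)·‖L‖₁ + 2δ·Σ_{n=1}^N |∂_n f(x)| · 1[Û_n ≠ sign(∂_n f(x))], where 1[·] is the indicator function. -/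
open Finset
open scoped RealInnerProductSpace

/-- Against a sign `u`, the product `-(u * g)` equals `-|g|`, corrected by `2 * |g|` when `u`
disagrees with the sign of `g`. -/
lemma neg_mul_eq_neg_abs_add_of_sign {u : ℝ} (hu : u = 1 ∨ u = -1) (g : ℝ) :
    -(u * g) = -|g| + 2 * (|g| * (if u ≠ sgn g then 1 else 0)) := by
  unfold sgn
  rcases le_or_gt 0 g with hg | hg
  · rcases hu with rfl | rfl
    · simp [hg, abs_of_nonneg hg]
    · norm_num [hg, abs_of_nonneg hg]; ring
  · rcases hu with rfl | rfl
    · norm_num [hg.not_ge, abs_of_neg hg]; ring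
    · norm_num [hg.not_ge, abs_of_neg hg]

/-- One-step descent bound for a signSGD-type update: if `f` is differentiable and
coordinate-wise smooth with constants `L n ≥ 0`, then for any point `x`, step size `δ > 0`
and sign vector `Û ∈ {-1,+1}^N`, the update `x' = x - δ·Û` satisfies
`f(x') - f(x) ≤ -δ‖∇f(x)‖₁ + (δ²/2)‖L‖₁ + 2δ ∑ₙ |∂ₙf(x)|·1[Ûₙ ≠ sign(∂ₙf(x))]`. -/
theorem signSGD_descent_step {N : ℕ} (f : EuclideanSpace ℝ (Fin N) → ℝ)
    (hf : Differentiable ℝ f) (L : Fin N → ℝ) (hL : ∀ n, 0 ≤ L n)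
    (hsmooth : ∀ x y : EuclideanSpace ℝ (Fin N),
      |f y - f x - ⟪gradient f x, y - x⟫| ≤ ∑ n, L n / 2 * (y n - x n) ^ 2)
    (x : EuclideanSpace ℝ (Fin N)) (δ : ℝ) (hδ : 0 < δ)
    (U : EuclideanSpace ℝ (Fin N)) (hU : ∀ n, U n = 1 ∨ U n = -1) :
    f (x - δ • U) - f x ≤
      -δ * (∑ n, |gradient f x n|) + δ ^ 2 / 2 * (∑ n, L n) +
        2 * δ * ∑ n, |gradient f x n| * (if U n ≠ sgn (gradient f x n) then 1 else 0) := by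
  have hinner : ⟪gradient f x, (x - δ • U) - x⟫ = δ * ∑ n, -(U n * gradient f x n) := by
    rw [PiLp.inner_apply, mul_sum]
    simp [mul_assoc]
  have hquad : ∑ n, L n / 2 * ((x - δ • U) n - x n) ^ 2 = δ ^ 2 / 2 * ∑ n, L n := by
    rw [mul_sum]
    refine sum_congr rfl fun n _ => ?_
    have hsq : U n ^ 2 = 1 := by rcases hU n with h | h <;> simp [h]
    simp only [PiLp.sub_apply, PiLp.smul_apply, smul_eq_mul]
    linear_combination L n / 2 * δ ^ 2 * hsq
  have hsign : ∑ n, -(U n * gradient f x n) = -(∑ n, |gradient f x n|) +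
      2 * ∑ n, |gradient f x n| * (if U n ≠ sgn (gradient f x n) then 1 else 0) := by
    rw [mul_sum, ← sum_neg_distrib, ← sum_add_distrib]
    exact sum_congr rfl fun n _ => neg_mul_eq_neg_abs_add_of_sign (hU n) _
  have hbound := (abs_le.mp (hsmooth x (x - δ • U))).2
  rw [hinner, hquad, hsign] at hbound
  linarith
end

section
/- Let f : ℝ^N → ℝ be differentiable and coordinate-wise smooth with constants L_1,…,L_N ≥ 0, let x ∈ ℝ^N be fixed, let δ > 0, and let Û be a random vector taking values in {−1,+1}^N such that P[Û_n ≠ sign(∂_n f(x))] ≤ P_E^max for every coordinate n, where P_E^max ∈ [0, 1/2]. Then E[f(x − δ·Û)] − f(x) ≤ −δ·(1 − 2·P_E^max)·‖∇f(x)‖₁ + (δ²/2)·‖L‖₁. -/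
open Finset MeasureTheory
open scoped ProbabilityTheory
open scoped RealInnerProductSpace

lemma mul_eq_abs_mul_one_sub_indicator {Ω : Type*} (a : ℝ) (u : Ω → ℝ)
    (hu : ∀ ω, u ω = 1 ∨ u ω = -1) (ω : Ω) :
    a * u ω = |a| * (1 - 2 * {ω | u ω ≠ sgn a}.indicator (fun _ => (1 : ℝ)) ω) := by
  by_cases ha : 0 ≤ a
  · rcases hu ω with h | h <;> simp [Set.indicator, sgn, ha, h, abs_of_nonneg] <;> norm_num
  · have ha' : |a| = -a := abs_of_neg (not_le.mp ha)
    rcases hu ω with h | h <;> simp [Set.indicator, sgn, ha, h, ha'] <;> norm_num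

/-- Expected one-step descent bound: if `f` is differentiable and coordinate-wise smooth,
`x` is fixed, `δ > 0`, and `Û` is a random sign vector whose coordinate-wise probability of
disagreeing with `sign(∂ₙ f(x))` is at most `P_E^max ∈ [0, 1/2]`, then
`E[f(x - δÛ)] - f(x) ≤ -δ(1 - 2·P_E^max)·‖∇f(x)‖₁ + (δ²/2)·‖L‖₁`. -/
theorem signSGD_expected_descent_step {N : ℕ} {Ω : Type*} [MeasureSpace Ω]
    [IsProbabilityMeasure (ℙ : Measure Ω)]
    (f : EuclideanSpace ℝ (Fin N) → ℝ) (hf : Differentiable ℝ f)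
    (L : Fin N → ℝ) (hL : ∀ n, 0 ≤ L n)
    (hsmooth : ∀ x y : EuclideanSpace ℝ (Fin N),
      |f y - f x - ⟪gradient f x, y - x⟫| ≤ ∑ n, L n / 2 * (y n - x n) ^ 2)
    (x : EuclideanSpace ℝ (Fin N)) (δ : ℝ) (hδ : 0 < δ)
    (U : Ω → EuclideanSpace ℝ (Fin N)) (hUmeas : Measurable U)
    (hUval : ∀ ω n, U ω n = 1 ∨ U ω n = -1)
    (PEmax : ℝ) (hPE0 : 0 ≤ PEmax) (hPE1 : PEmax ≤ 1 / 2)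
    (hPE : ∀ n, (ℙ {ω | U ω n ≠ sgn (gradient f x n)}).toReal ≤ PEmax) :
    (∫ ω, f (x - δ • U ω) ∂ℙ) - f x ≤
      -δ * (1 - 2 * PEmax) * (∑ n, |gradient f x n|) + δ ^ 2 / 2 * (∑ n, L n) := by
  set g := gradient f x with hg
  set s : Fin N → Set Ω := fun n => {ω | U ω n ≠ sgn (g n)} with hs
  have hUn : ∀ n, Measurable fun ω => U ω n := fun n => by fun_prop
  have hsm : ∀ n, MeasurableSet (s n) := fun n =>
    (hUn n (measurableSet_singleton (sgn (g n)))).compl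
  have hstep : ∀ ω, |f (x - δ • U ω) - f x + δ * ∑ n, g n * U ω n|
      ≤ δ ^ 2 / 2 * ∑ n, L n := by
    intro ω
    have h := hsmooth x (x - δ • U ω)
    have hinner : ⟪gradient f x, x - δ • U ω - x⟫ = -(δ * ∑ n, g n * U ω n) := by
      rw [sub_sub_cancel_left, inner_neg_right, real_inner_smul_right, PiLp.inner_apply]
      simp [hg, mul_comm]
    have hsum : ∑ n, L n / 2 * ((x - δ • U ω) n - x n) ^ 2 = δ ^ 2 / 2 * ∑ n, L n := by
      rw [mul_sum]
      refine sum_congr rfl fun n _ => ?_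
      have hsq : U ω n ^ 2 = 1 := by rcases hUval ω n with h | h <;> simp [h]
      simp only [PiLp.sub_apply, PiLp.smul_apply, smul_eq_mul]
      linear_combination L n / 2 * δ ^ 2 * hsq
    rwa [hinner, hsum, sub_neg_eq_add] at h
  have habs : ∀ ω, |∑ n, g n * U ω n| ≤ ∑ n, |g n| := fun ω =>
    (abs_sum_le_sum_abs _ _).trans (sum_le_sum fun n _ => by
      rcases hUval ω n with h | h <;> simp [h])
  have hint : Integrable (fun ω => f (x - δ • U ω)) ℙ := by
    refine Integrable.of_bound
      (hf.continuous.measurable.comp (by fun_prop)).aestronglyMeasurable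
      (|f x| + δ * ∑ n, |g n| + δ ^ 2 / 2 * ∑ n, L n) (ae_of_all _ fun ω => ?_)
    have h₁ := abs_le.mp (hstep ω)
    have h₂ := abs_le.mp (habs ω)
    have h₃ := mul_le_mul_of_nonneg_left h₂.1 hδ.le
    have h₄ := mul_le_mul_of_nonneg_left h₂.2 hδ.le
    rw [Real.norm_eq_abs, abs_le]
    constructor <;> linarith [h₁.1, h₁.2, neg_abs_le (f x), le_abs_self (f x)]
  have hind : ∀ n, Integrable ((s n).indicator fun _ => (1 : ℝ)) ℙ := fun n =>
    (integrable_const 1).indicator (hsm n)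
  have hterm : ∀ n, Integrable
      (fun ω => |g n| * (1 - 2 * (s n).indicator (fun _ => (1 : ℝ)) ω)) ℙ := fun n =>
    ((integrable_const 1).sub ((hind n).const_mul 2)).const_mul _
  have hsumint := integrable_finsetSum univ fun n _ => hterm n
  have hmono : ∫ ω, f (x - δ • U ω) ∂ℙ ≤ ∫ ω, ((f x + δ ^ 2 / 2 * ∑ n, L n) -
      δ * ∑ n, |g n| * (1 - 2 * (s n).indicator (fun _ => (1 : ℝ)) ω)) ∂ℙ := by
    refine integral_mono hint ((integrable_const _).sub (hsumint.const_mul δ)) fun ω => ?_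
    have h := (abs_le.mp (hstep ω)).2
    simp only [fun n => mul_eq_abs_mul_one_sub_indicator (g n) (fun ω => U ω n)
      (fun ω => hUval ω n) ω] at h
    change _ ≤ _ - _
    linarith
  rw [integral_sub (integrable_const _) (hsumint.const_mul δ), integral_const_mul,
    integral_finsetSum _ fun n _ => hterm n] at hmono
  have hlower : (1 - 2 * PEmax) * ∑ n, |g n| ≤
      ∑ n, ∫ ω, |g n| * (1 - 2 * (s n).indicator (fun _ => (1 : ℝ)) ω) ∂ℙ := by
    rw [mul_sum]
    refine sum_le_sum fun n _ => ?_
    rw [integral_const_mul, integral_sub (integrable_const _) ((hind n).const_mul 2),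
      integral_const_mul, integral_indicator_const _ (hsm n), mul_comm]
    have h : (ℙ : Measure Ω).real (s n) ≤ PEmax := hPE n
    refine mul_le_mul_of_nonneg_left ?_ (abs_nonneg _)
    simp only [integral_const, probReal_univ, smul_eq_mul]
    linarith
  have h := mul_le_mul_of_nonneg_left hlower hδ.le
  simp only [integral_const, probReal_univ, smul_eq_mul] at hmono
  linarith
end

section
/- For every p ∈ (0, 1) with p ≠ 1/2 and every real t, (1 − p)·exp(−t·p) + p·exp(t·(1 − p)) ≤ exp(((1 − 2p)/(4·ln((1 − p)/p)))·t²). -/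
open Real Set in
theorem antitoneOn_sinh_div_mul_cosh :
    AntitoneOn (fun s : ℝ => sinh s / (s * cosh s)) (Ioi 0) := by
  have hd : ∀ s ∈ Ioi (0 : ℝ), HasDerivAt (fun s : ℝ => sinh s / (s * cosh s))
      ((cosh s * (s * cosh s) - sinh s * (1 * cosh s + s * sinh s)) / (s * cosh s) ^ 2) s := by
    intro s hs
    exact (hasDerivAt_sinh s).div ((hasDerivAt_id s).mul (hasDerivAt_cosh s))
      (mul_pos hs (cosh_pos s)).ne'
  refine antitoneOn_of_deriv_nonpos (convex_Ioi 0)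
    (fun s hs => (hd s hs).continuousAt.continuousWithinAt) ?_ ?_
  · rw [interior_Ioi]
    exact fun s hs => (hd s hs).differentiableAt.differentiableWithinAt
  · rw [interior_Ioi]
    intro s hs
    rw [(hd s hs).deriv]
    have hs' : 0 ≤ s := le_of_lt hs
    have h1 : s ≤ sinh s := self_le_sinh_iff.2 hs'
    have h2 := one_le_cosh s
    have h3 := cosh_sq s
    apply div_nonpos_of_nonpos_of_nonneg _ (sq_nonneg _)
    nlinarith [mul_nonneg (hs'.trans h1) (sub_nonneg.2 h2)]

open Real Set in
theorem log_cosh_sub_log_cosh_le_of_nonneg {a s : ℝ} (ha : 0 < a) (hs : 0 ≤ s) :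
    log (cosh s) - log (cosh a) ≤ sinh a / (a * cosh a) / 2 * (s ^ 2 - a ^ 2) := by
  set c := sinh a / (a * cosh a) with hc
  have hd : ∀ x : ℝ, HasDerivAt (fun x => c / 2 * x ^ 2 - log (cosh x))
      (c * x - sinh x / cosh x) x := by
    intro x
    have h1 := ((hasDerivAt_pow 2 x).const_mul (c / 2)).sub
      ((hasDerivAt_cosh x).log (cosh_pos x).ne')
    refine h1.congr_deriv ?_
    norm_num
    ring
  have hfac : ∀ x : ℝ, 0 < x →
      c * x - sinh x / cosh x = x * (c - sinh x / (x * cosh x)) := by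
    intro x hx
    have := (cosh_pos x).ne'
    field_simp
  have hcont : Continuous (fun x => c / 2 * x ^ 2 - log (cosh x)) :=
    continuous_iff_continuousAt.2 fun x => (hd x).continuousAt
  suffices h : c / 2 * a ^ 2 - log (cosh a) ≤ c / 2 * s ^ 2 - log (cosh s) by linarith
  rcases le_total s a with hsa | hsa
  · have hanti : AntitoneOn (fun x => c / 2 * x ^ 2 - log (cosh x)) (Icc 0 a) := by
      refine antitoneOn_of_deriv_nonpos (convex_Icc 0 a) hcont.continuousOn
        (fun x _ => (hd x).differentiableAt.differentiableWithinAt) ?_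
      rw [interior_Icc]
      intro x hx
      rw [(hd x).deriv, hfac x hx.1]
      exact mul_nonpos_of_nonneg_of_nonpos hx.1.le
        (sub_nonpos.2 (antitoneOn_sinh_div_mul_cosh hx.1 ha hx.2.le))
    exact hanti ⟨hs, hsa⟩ ⟨ha.le, le_rfl⟩ hsa
  · have hmono : MonotoneOn (fun x => c / 2 * x ^ 2 - log (cosh x)) (Ici a) := by
      refine monotoneOn_of_deriv_nonneg (convex_Ici a) hcont.continuousOn
        (fun x _ => (hd x).differentiableAt.differentiableWithinAt) ?_
      rw [interior_Ici]
      intro x hx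
      have hx0 : 0 < x := ha.trans hx
      rw [(hd x).deriv, hfac x hx0]
      exact mul_nonneg hx0.le
        (sub_nonneg.2 (antitoneOn_sinh_div_mul_cosh ha hx0 (le_of_lt hx)))
    exact hmono self_mem_Ici hsa hsa

open Real in
theorem log_cosh_sub_log_cosh_le {a : ℝ} (ha : a ≠ 0) (s : ℝ) :
    log (cosh s) - log (cosh a) ≤ sinh a / (a * cosh a) / 2 * (s ^ 2 - a ^ 2) := by
  have h := log_cosh_sub_log_cosh_le_of_nonneg (abs_pos.2 ha) (abs_nonneg s)
  rw [cosh_abs, cosh_abs, sq_abs, sq_abs] at h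
  rcases abs_choice a with h' | h' <;> rw [h'] at h
  · exact h
  · rwa [sinh_neg, neg_mul, neg_div_neg_eq] at h

/-- Large deviation bound (Kearns–Saul type): for `p ∈ (0,1)`, `p ≠ 1/2`, and any real `t`,
`(1 - p) e^{-tp} + p e^{t(1-p)} ≤ exp( (1-2p)/(4 ln((1-p)/p)) · t² )`. -/
theorem kearns_saul_inequality (p t : ℝ) (hp0 : 0 < p) (hp1 : p < 1) (hp : p ≠ 1 / 2) :
    (1 - p) * Real.exp (-t * p) + p * Real.exp (t * (1 - p)) ≤
      Real.exp ((1 - 2 * p) / (4 * Real.log ((1 - p) / p)) * t ^ 2) := by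
  have hq : 0 < 1 - p := by linarith
  obtain ⟨a, ha⟩ : ∃ a, a = Real.log ((1 - p) / p) / 2 := ⟨_, rfl⟩
  have hlog : Real.log ((1 - p) / p) = 2 * a := by linarith
  have hexp : Real.exp a * Real.exp a = (1 - p) / p := by
    rw [← Real.exp_add, ← two_mul, ← hlog, Real.exp_log (div_pos hq hp0)]
  have ha0 : a ≠ 0 := by
    rintro rfl
    rw [Real.exp_zero, eq_div_iff hp0.ne'] at hexp
    exact hp (by linarith)
  have hcosh := Real.cosh_pos a
  have hinv : Real.exp a * Real.exp (-a) = 1 := by rw [← Real.exp_add]; simp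
  have hq_eq : (1 - p) * Real.exp (-a) = p * Real.exp a := by
    rw [eq_div_iff hp0.ne'] at hexp
    linear_combination (-Real.exp (-a)) * hexp + p * Real.exp a * hinv
  have hp_cosh : 2 * Real.cosh a * p = Real.exp (-a) := by
    rw [Real.cosh_eq]
    linear_combination -hq_eq
  have hq_cosh : 2 * Real.cosh a * (1 - p) = Real.exp a := by
    have := Real.cosh_eq a
    linear_combination 2 * this - hp_cosh
  have htanh : Real.sinh a = (1 - 2 * p) * Real.cosh a := by
    rw [Real.sinh_eq]
    linear_combination (hp_cosh - hq_cosh) / 2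
  have hlhs : (1 - p) * Real.exp (-t * p) + p * Real.exp (t * (1 - p)) =
      Real.exp (t / 2 * (1 - 2 * p) + (Real.log (Real.cosh (a - t / 2)) -
        Real.log (Real.cosh a))) := by
    rw [Real.exp_add, Real.exp_sub, Real.exp_log (Real.cosh_pos _), Real.exp_log hcosh,
      mul_div_assoc', eq_div_iff hcosh.ne', Real.cosh_eq (a - t / 2)]
    have e1 : Real.exp (t / 2 * (1 - 2 * p)) * Real.exp (a - t / 2) =
        Real.exp a * Real.exp (-t * p) := by
      rw [← Real.exp_add, ← Real.exp_add]; ring_nf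
    have e2 : Real.exp (t / 2 * (1 - 2 * p)) * Real.exp (-(a - t / 2)) =
        Real.exp (-a) * Real.exp (t * (1 - p)) := by
      rw [← Real.exp_add, ← Real.exp_add]; ring_nf
    linear_combination (hq_cosh * Real.exp (-t * p) + hp_cosh * Real.exp (t * (1 - p))
      - e1 - e2) / 2
  rw [hlhs, Real.exp_le_exp, hlog]
  have h := log_cosh_sub_log_cosh_le ha0 (a - t / 2)
  have hc : Real.sinh a / (a * Real.cosh a) = (1 - 2 * p) / a := by
    rw [htanh, mul_div_mul_right _ _ hcosh.ne']
  rw [hc] at h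
  have hr : (1 - 2 * p) / (4 * (2 * a)) * t ^ 2 =
      t / 2 * (1 - 2 * p) + (1 - 2 * p) / a / 2 * ((a - t / 2) ^ 2 - a ^ 2) := by
    field_simp
    ring
  rw [hr]
  linarith
end

section
/- Let Z be a Bernoulli random variable with P[Z = 1] = p ∈ (0, 1/2), let w = ln((1 − p)/p) > 0, let δ_max ≥ 0, and let ŵ be a real number with 0 < ŵ ≤ (1 + δ_max)·w. Then for every real s, E[exp(s·ŵ·(Z − p))] = p·exp(s·ŵ·(1 − p)) + (1 − p)·exp(−s·ŵ·p) ≤ exp(((1 + δ_max)/2)·((1/2) − p)·ŵ·s²). -/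
open MeasureTheory ProbabilityTheory
open scoped ProbabilityTheory

/-- The function `sinh u / u` is increasing on the positive reals. -/
lemma mul_sinh_le_mul_sinh {u v : ℝ} (hu : 0 ≤ u) (huv : u ≤ v) :
    v * Real.sinh u ≤ u * Real.sinh v := by
  have hd : ∀ x, HasDerivAt (fun x => u * Real.sinh x - x * Real.sinh u)
      (u * Real.cosh x - 1 * Real.sinh u) x := fun x =>
    ((Real.hasDerivAt_sinh x).const_mul u).sub ((hasDerivAt_id x).mul_const _)
  have hsinh : Real.sinh u ≤ u * Real.cosh u := by
    have hd' : ∀ x, HasDerivAt (fun x => x * Real.cosh x - Real.sinh x)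
        (1 * Real.cosh x + x * Real.sinh x - Real.cosh x) x := fun x =>
      ((hasDerivAt_id x).mul (Real.hasDerivAt_cosh x)).sub (Real.hasDerivAt_sinh x)
    have hm : MonotoneOn (fun x => x * Real.cosh x - Real.sinh x) (Set.Ici 0) := by
      refine monotoneOn_of_deriv_nonneg (convex_Ici 0)
        (fun x _ => (hd' x).continuousAt.continuousWithinAt)
        (fun x _ => (hd' x).differentiableAt.differentiableWithinAt) fun x hx => ?_
      rw [interior_Ici] at hx
      have hx0 : 0 < x := hx
      rw [(hd' x).deriv]
      nlinarith [mul_pos hx0 (Real.sinh_pos_iff.2 hx0)]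
    have := hm (Set.mem_Ici.2 le_rfl) (Set.mem_Ici.2 hu) hu
    simp only [zero_mul, Real.sinh_zero, sub_zero] at this
    linarith
  have hm : MonotoneOn (fun x => u * Real.sinh x - x * Real.sinh u) (Set.Ici u) := by
    refine monotoneOn_of_deriv_nonneg (convex_Ici u)
      (fun x _ => (hd x).continuousAt.continuousWithinAt)
      (fun x _ => (hd x).differentiableAt.differentiableWithinAt) fun x hx => ?_
    rw [interior_Ici] at hx
    have hx0 : u < x := hx
    rw [(hd x).deriv]
    have hc : Real.cosh u ≤ Real.cosh x :=
      Real.cosh_le_cosh.2 (by rw [abs_of_nonneg hu, abs_of_pos (hu.trans_lt hx0)]; exact hx0.le)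
    nlinarith [mul_le_mul_of_nonneg_left hc hu]
  have := hm (Set.mem_Ici.2 le_rfl) (Set.mem_Ici.2 huv) huv
  simp only at this
  linarith

/-- The function `tanh x / x` is decreasing on the positive reals. -/
lemma mul_tanh_le_mul_tanh {x y : ℝ} (hx : 0 ≤ x) (hxy : x ≤ y) :
    x * Real.tanh y ≤ y * Real.tanh x := by
  have h := mul_sinh_le_mul_sinh (u := y - x) (v := y + x) (by linarith) (by linarith)
  rw [Real.sinh_sub, Real.sinh_add] at h
  rw [Real.tanh_eq_sinh_div_cosh, Real.tanh_eq_sinh_div_cosh, mul_div_assoc', mul_div_assoc',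
    div_le_div_iff₀ (Real.cosh_pos _) (Real.cosh_pos _)]
  nlinarith

/-- The Jaakkola–Jordan bound: `log (cosh √u)` lies below its tangents. -/
lemma log_cosh_le_quadratic {a : ℝ} (ha : 0 < a) (x : ℝ) :
    Real.log (Real.cosh x) ≤
      Real.log (Real.cosh a) + Real.tanh a / (2 * a) * (x ^ 2 - a ^ 2) := by
  wlog hx : 0 ≤ x generalizing x
  · simpa using this (-x) (by linarith)
  set f : ℝ → ℝ := fun x => Real.tanh a / (2 * a) * (x ^ 2 - a ^ 2) - Real.log (Real.cosh x)
  have hd : ∀ y, HasDerivAt f ((y * Real.tanh a - a * Real.tanh y) / a) y := fun y => by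
    have h := ((((hasDerivAt_id y).pow 2).sub_const (a ^ 2)).const_mul
      (Real.tanh a / (2 * a))).sub ((Real.hasDerivAt_cosh y).log (Real.cosh_pos y).ne')
    refine h.congr_deriv ?_
    rw [Real.tanh_eq_sinh_div_cosh y]
    simp only [id]
    have := (Real.cosh_pos y).ne'
    field_simp
    norm_num
    ring
  have hc : Continuous f := continuous_iff_continuousAt.2 fun y => (hd y).continuousAt
  have hf : f a ≤ f x := by
    rcases le_total x a with hxa | hxa
    · refine antitoneOn_of_deriv_nonpos (convex_Icc 0 a) hc.continuousOn
        (fun y _ => (hd y).differentiableAt.differentiableWithinAt) (fun y hy => ?_)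
        ⟨hx, hxa⟩ ⟨ha.le, le_rfl⟩ hxa
      rw [interior_Icc] at hy
      rw [(hd y).deriv]
      exact div_nonpos_of_nonpos_of_nonneg
        (sub_nonpos.2 (mul_tanh_le_mul_tanh hy.1.le hy.2.le)) ha.le
    · refine monotoneOn_of_deriv_nonneg (convex_Ici a) hc.continuousOn
        (fun y _ => (hd y).differentiableAt.differentiableWithinAt) (fun y hy => ?_)
        (Set.mem_Ici.2 le_rfl) (Set.mem_Ici.2 hxa) hxa
      rw [interior_Ici] at hy
      rw [(hd y).deriv]
      exact div_nonneg (sub_nonneg.2 (mul_tanh_le_mul_tanh ha.le (Set.mem_Ioi.1 hy).le)) ha.le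
  simp only [f, sub_self, mul_zero, zero_sub] at hf
  linarith

/-- The Kearns–Saul inequality for a centered Bernoulli variable. -/
lemma kearns_saul {p : ℝ} (hp0 : 0 < p) (hp1 : p < 1 / 2) (t : ℝ) :
    p * Real.exp (t * (1 - p)) + (1 - p) * Real.exp (-(t * p)) ≤
      Real.exp ((1 - 2 * p) / (4 * Real.log ((1 - p) / p)) * t ^ 2) := by
  set a := Real.log ((1 - p) / p) / 2 with ha_def
  have hq : 0 < 1 - p := by linarith
  have hlog : Real.log ((1 - p) / p) = 2 * a := by rw [ha_def]; ring
  have ha : 0 < a := half_pos (Real.log_pos (by rw [lt_div_iff₀ hp0]; linarith))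
  have hexp : p * (Real.exp a * Real.exp a) = 1 - p := by
    rw [← Real.exp_add, ← two_mul, ← hlog, Real.exp_log (div_pos hq hp0)]
    field_simp
  have hinv : Real.exp (-a) * Real.exp a = 1 := by rw [← Real.exp_add]; simp
  have hcosh : 2 * p * Real.exp a * Real.cosh a = 1 := by
    rw [Real.cosh_eq]
    linear_combination hexp + p * hinv
  have htanh : Real.tanh a = 1 - 2 * p := by
    rw [Real.tanh_eq_sinh_div_cosh, div_eq_iff (Real.cosh_pos a).ne', Real.sinh_eq, Real.cosh_eq]
    have : Real.exp (-a) * (1 - p) = p * Real.exp a := by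
      rw [← hexp]
      linear_combination p * Real.exp a * hinv
    linear_combination -this
  have hmain := log_cosh_le_quadratic ha (t / 2 - a)
  rw [Real.log_le_iff_le_exp (Real.cosh_pos _), Real.exp_add, Real.exp_log (Real.cosh_pos a),
    htanh] at hmain
  have hlhs : p * Real.exp (t * (1 - p)) + (1 - p) * Real.exp (-(t * p)) =
      2 * p * Real.exp a * Real.exp (t / 2 - t * p) * Real.cosh (t / 2 - a) := by
    have h1 : Real.exp (t * (1 - p)) =
        Real.exp a * Real.exp (t / 2 - t * p) * Real.exp (t / 2 - a) := by
      rw [← Real.exp_add, ← Real.exp_add]; congr 1; ring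
    have h2 : Real.exp a * Real.exp (-(t * p)) =
        Real.exp (t / 2 - t * p) * Real.exp (-(t / 2 - a)) := by
      rw [← Real.exp_add, ← Real.exp_add]; congr 1; ring
    rw [Real.cosh_eq, h1, ← hexp]
    linear_combination p * Real.exp a * h2
  calc p * Real.exp (t * (1 - p)) + (1 - p) * Real.exp (-(t * p))
      ≤ 2 * p * Real.exp a * Real.exp (t / 2 - t * p) * (Real.cosh a *
          Real.exp ((1 - 2 * p) / (2 * a) * ((t / 2 - a) ^ 2 - a ^ 2))) := by
        rw [hlhs]; gcongr
    _ = Real.exp (t / 2 - t * p) *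
          Real.exp ((1 - 2 * p) / (2 * a) * ((t / 2 - a) ^ 2 - a ^ 2)) := by
        linear_combination Real.exp (t / 2 - t * p) *
          Real.exp ((1 - 2 * p) / (2 * a) * ((t / 2 - a) ^ 2 - a ^ 2)) * hcosh
    _ = Real.exp ((1 - 2 * p) / (4 * Real.log ((1 - p) / p)) * t ^ 2) := by
        rw [← Real.exp_add, hlog]
        congr 1
        field_simp
        ring

/-- Moment generating function bound for a weighted, centered Bernoulli variable: if `Z` is
Bernoulli(`p`) with `p ∈ (0,1/2)`, `w = ln((1-p)/p) > 0`, `δ_max ≥ 0`, and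
`0 < ŵ ≤ (1+δ_max)·w`, then for all real `s`,
`E[exp(s ŵ (Z - p))] = p·exp(s ŵ (1-p)) + (1-p)·exp(-s ŵ p)
  ≤ exp(((1+δ_max)/2)·(1/2 - p)·ŵ·s²)`. -/
theorem bernoulli_weighted_mgf_bound {Ω : Type*} [MeasureSpace Ω]
    [IsProbabilityMeasure (ℙ : Measure Ω)]
    (p : ℝ) (hp : p ∈ Set.Ioo (0 : ℝ) (1 / 2))
    (Z : Ω → ℝ) (hZmeas : Measurable Z) (hZval : ∀ ω, Z ω = 0 ∨ Z ω = 1)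
    (hZp : ℙ {ω | Z ω = 1} = ENNReal.ofReal p)
    (w : ℝ) (hw : w = Real.log ((1 - p) / p))
    (δmax : ℝ) (hδmax : 0 ≤ δmax)
    (wEst : ℝ) (hwEst0 : 0 < wEst) (hwEst : wEst ≤ (1 + δmax) * w) (s : ℝ) :
    (∫ ω, Real.exp (s * wEst * (Z ω - p)) ∂ℙ) =
        p * Real.exp (s * wEst * (1 - p)) + (1 - p) * Real.exp (-(s * wEst * p)) ∧
      p * Real.exp (s * wEst * (1 - p)) + (1 - p) * Real.exp (-(s * wEst * p)) ≤
        Real.exp ((1 + δmax) / 2 * (1 / 2 - p) * wEst * s ^ 2) := by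
  obtain ⟨hp0, hp1⟩ := hp
  refine ⟨?_, (kearns_saul hp0 hp1 (s * wEst)).trans (Real.exp_le_exp.2 ?_)⟩
  · have hA : MeasurableSet {ω | Z ω = 1} := hZmeas (measurableSet_singleton 1)
    have hfun : (fun ω => Real.exp (s * wEst * (Z ω - p))) = fun ω =>
        Real.exp (-(s * wEst * p)) + {ω | Z ω = 1}.indicator
          (fun _ => Real.exp (s * wEst * (1 - p)) - Real.exp (-(s * wEst * p))) ω := by
      funext ω
      rcases hZval ω with h | h <;> simp [Set.indicator, h]
    rw [hfun, integral_add (integrable_const _) ((integrable_const _).indicator hA),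
      integral_indicator_const _ hA, measureReal_def, hZp, ENNReal.toReal_ofReal hp0.le]
    simp only [integral_const, probReal_univ, smul_eq_mul]
    ring
  · have hw0 : 0 < w := by
      rw [hw]
      exact Real.log_pos (by rw [lt_div_iff₀ hp0]; linarith)
    rw [← hw, div_mul_eq_mul_div, div_le_iff₀ (by positivity)]
    have hc : 0 ≤ (1 - 2 * p) * wEst * s ^ 2 :=
      mul_nonneg (mul_nonneg (by linarith) hwEst0.le) (sq_nonneg s)
    linear_combination mul_le_mul_of_nonneg_left hwEst hc
end
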